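/- Let G = ℤ/Nℤ with N odd, let B be a regular Bohr set of rank d, and let ρ, δ > 0 satisfy ρ + δ < 1/(100d). Let μ : G → ℝ_{≥0} be a probability measure supported on the dilate B_ρ. Then ‖μ_{B_{1+δ}}∗μ − μ_{B_{1+δ}}‖₁ ≤ 200(ρ + δ)d. -/

import Mathlib

open Finset BigOperators Pointwise
open scoped Classical

namespace Formal

variable {G : Type*} [AddCommGroup G] [Fintype G]

/-- `ex f = 𝔼_{x ∈ G} f x`. -/
noncomputable def ex (f : G → ℝ) : ℝ := (∑ x, f x) / (Fintype.card G : ℝ)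

/-- `ip f g = ⟨f, g⟩ = 𝔼_x f x * g x`. -/
noncomputable def ip (f g : G → ℝ) : ℝ := ex (fun x => f x * g x)

/-- `ipWt ν f g = ⟨f, g⟩_ν = 𝔼_x f x * g x * ν x`. -/
noncomputable def ipWt (ν f g : G → ℝ) : ℝ := ex (fun x => f x * g x * ν x)

/-- Convolution `f ∗ g (x) = 𝔼_y f y * g (x - y)`. -/
noncomputable def cv (f g : G → ℝ) : G → ℝ := fun x => ex (fun y => f y * g (x - y))

/-- Difference convolution `f ∘ g (x) = 𝔼_y f y * g (x + y)`. -/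
noncomputable def dcv (f g : G → ℝ) : G → ℝ := fun x => ex (fun y => f y * g (x + y))

/-- Normalized indicator measure `μ_A = (|G|/|A|) · 1_A`. -/
noncomputable def mu (A : Set G) : G → ℝ :=
  fun x => if x ∈ A then (Fintype.card G : ℝ) / (Nat.card A : ℝ) else 0

/-- Density `|A|/|G|`. -/
noncomputable def density (A : Set G) : ℝ := (Nat.card A : ℝ) / (Fintype.card G : ℝ)

/-- Relative density `|A|/|B|`. -/
noncomputable def relDensity (A B : Set G) : ℝ := (Nat.card A : ℝ) / (Nat.card B : ℝ)

/-- `‖f‖_p = (𝔼_x |f x|^p)^{1/p}`. -/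
noncomputable def lpNorm (p : ℝ) (f : G → ℝ) : ℝ := (ex (fun x => |f x| ^ p)) ^ (1 / p)

/-- `‖f‖_{p(ν)} = (𝔼_x |f x|^p ν x)^{1/p}`. -/
noncomputable def lpNormWt (p : ℝ) (ν f : G → ℝ) : ℝ := (ex (fun x => |f x| ^ p * ν x)) ^ (1 / p)

/-- `‖f‖_∞ = max_x |f x|`. -/
noncomputable def linftyNorm (f : G → ℝ) : ℝ := ⨆ x, |f x|

/-- `‖f‖_1 = 𝔼_x |f x|`. -/
noncomputable def l1Norm (f : G → ℝ) : ℝ := ex (fun x => |f x|)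

/-- Indicator function of a set. -/
noncomputable def indic (S : Set G) : G → ℝ := fun x => if x ∈ S then 1 else 0

/-- `Lq α = log (2/α)`. -/
noncomputable def Lq (α : ℝ) : ℝ := Real.log (2 / α)

/-- `iterConv f k` is the `k`-fold convolution `f ∗ ⋯ ∗ f` (for `k ≥ 1`);
`iterConv f 0` is the convolution identity. -/
noncomputable def iterConv (f : G → ℝ) : ℕ → G → ℝ
  | 0 => fun x => if x = 0 then (Fintype.card G : ℝ) else 0
  | n + 1 => cv (iterConv f n) f

/-- Fourier transform `f̂ γ = 𝔼_x f x * conj (γ x)`. -/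
noncomputable def ft (f : G → ℝ) (γ : AddChar G ℂ) : ℂ :=
  (∑ x, (f x : ℂ) * (starRingEnd ℂ) (γ x)) / (Fintype.card G : ℝ)

/-- The large spectrum `Δ_{1/2}(X)` of the measure `μ_X`. -/
noncomputable def Delta (X : Set G) : Set (AddChar G ℂ) :=
  {γ | 1 / 2 ≤ ‖ft (mu X) γ‖}

/-- A Bohr set: a finite set of characters together with a radius. -/
structure Bohr (G : Type*) [AddCommGroup G] where
  freq : Finset (AddChar G ℂ)
  radius : ℝ

namespace Bohr

variable {G : Type*} [AddCommGroup G]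

/-- The underlying set `{x : |1 - γ x| ≤ ρ for all γ ∈ Λ}` of a Bohr set. -/
def carrier (B : Bohr G) : Set G := {x | ∀ γ ∈ B.freq, ‖(1 : ℂ) - γ x‖ ≤ B.radius}

/-- The rank `|Λ|` of a Bohr set. -/
def rank (B : Bohr G) : ℕ := B.freq.card

/-- The dilate `B_δ` of a Bohr set. -/
def dilate (B : Bohr G) (δ : ℝ) : Bohr G := ⟨B.freq, δ * B.radius⟩

/-- A Bohr set of rank `d` is regular if for all `|κ| ≤ 1/(100d)`,
`(1 - 100d|κ|)|B| ≤ |B_{1+κ}| ≤ (1 + 100d|κ|)|B|`. -/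
def Regular (B : Bohr G) : Prop :=
  ∀ κ : ℝ, |κ| ≤ 1 / (100 * B.rank) →
    (1 - 100 * B.rank * |κ|) * (Nat.card B.carrier : ℝ) ≤
        (Nat.card ((B.dilate (1 + κ)).carrier) : ℝ) ∧
    (Nat.card ((B.dilate (1 + κ)).carrier) : ℝ) ≤
        (1 + 100 * B.rank * |κ|) * (Nat.card B.carrier : ℝ)

/-- `B' ⊂_r B` : `B'` is a regular dilate `B_δ` of `B` with `δ ∈ [r/2, r]`. -/
def subR (r : ℝ) (B' B : Bohr G) : Prop :=
  ∃ δ : ℝ, r / 2 ≤ δ ∧ δ ≤ r ∧ B' = B.dilate δ ∧ B'.Regular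

/-- The density `μ(B) = |B|/|G|` of a Bohr set. -/
noncomputable def dens (B : Bohr G) : ℝ := (Nat.card B.carrier : ℝ) / (Nat.card G : ℝ)

end Bohr

theorem ex_mono {ι : Type*} [Fintype ι] {f g : ι → ℝ} (h : ∀ x, f x ≤ g x) : ex f ≤ ex g :=
  div_le_div_of_nonneg_right (Finset.sum_le_sum fun x _ => h x) (Nat.cast_nonneg _)

theorem ex_add {ι : Type*} [Fintype ι] (f g : ι → ℝ) : ex (fun x => f x + g x) = ex f + ex g := by
  simp only [ex, Finset.sum_add_distrib, add_div]

theorem ex_sub {ι : Type*} [Fintype ι] (f g : ι → ℝ) : ex (fun x => f x - g x) = ex f - ex g := by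
  simp only [ex, Finset.sum_sub_distrib, sub_div]

theorem ex_const_mul {ι : Type*} [Fintype ι] (c : ℝ) (f : ι → ℝ) :
    ex (fun x => c * f x) = c * ex f := by
  simp only [ex, ← Finset.mul_sum, mul_div_assoc]

theorem ex_comm {ι : Type*} [Fintype ι] (F : ι → ι → ℝ) :
    ex (fun x => ex (fun y => F x y)) = ex (fun y => ex (fun x => F x y)) := by
  simp only [ex, ← Finset.sum_div]
  rw [Finset.sum_comm]

theorem abs_ex_le {ι : Type*} [Fintype ι] (f : ι → ℝ) : |ex f| ≤ ex (fun x => |f x|) := by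
  unfold ex
  rw [abs_div, Nat.abs_cast]
  exact div_le_div_of_nonneg_right (Finset.abs_sum_le_sum_abs _ _) (Nat.cast_nonneg _)

theorem ex_comp_sub_right (f : G → ℝ) (y : G) : ex (fun x => f (x - y)) = ex f := by
  unfold ex
  rw [(Equiv.subRight y).sum_comp f |>.symm]
  rfl

theorem ex_comp_sub_left (f : G → ℝ) (x : G) : ex (fun y => f (x - y)) = ex f := by
  unfold ex
  rw [(Equiv.subLeft x).sum_comp f |>.symm]
  rfl

theorem cv_comm (f g : G → ℝ) : cv f g = cv g f := by
  funext x
  unfold cv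
  rw [← ex_comp_sub_left _ x]
  simp only [sub_sub_cancel, mul_comm]

theorem ex_indic {ι : Type*} [Fintype ι] (A : Set ι) : ex (indic A) = density A := by
  simp only [ex, indic, density, Finset.sum_boole, Nat.card_eq_fintype_card, Fintype.card_subtype]

theorem mu_eq_mul_indic {ι : Type*} [Fintype ι] (A : Set ι) (x : ι) :
    mu A x = (Fintype.card ι : ℝ) / (Nat.card A : ℝ) * indic A x := by
  simp only [mu, indic, mul_ite, mul_one, mul_zero]

theorem ex_mu {ι : Type*} [Fintype ι] {A : Set ι} (hA : A.Nonempty) : ex (mu A) = 1 := by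
  have : Nonempty ι := ⟨hA.some⟩
  have : Nonempty A := hA.to_subtype
  have hG : (Fintype.card ι : ℝ) ≠ 0 := Nat.cast_ne_zero.2 Fintype.card_ne_zero
  have hA' : (Nat.card A : ℝ) ≠ 0 := Nat.cast_ne_zero.2 Nat.card_pos.ne'
  rw [funext (mu_eq_mul_indic A), ex_const_mul, ex_indic, density]
  field_simp

/-- Convolving with a probability measure moves `f` in `L¹` by at most the largest amount by which
a translate by an element of the support does. -/
theorem l1Norm_cv_sub_le {f μ : G → ℝ} {C : ℝ} (hμ0 : ∀ x, 0 ≤ μ x) (hμ1 : ex μ = 1)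
    (hC : ∀ y, μ y ≠ 0 → l1Norm (fun x => f (x - y) - f x) ≤ C) :
    l1Norm (fun x => cv f μ x - f x) ≤ C := by
  have key : ∀ x, cv f μ x - f x = ex (fun y => μ y * (f (x - y) - f x)) := by
    intro x
    simp only [mul_sub, ex_sub]
    rw [cv_comm, show (fun y => μ y * f x) = fun y => f x * μ y from funext fun y => mul_comm _ _,
      ex_const_mul, hμ1, mul_one]
    rfl
  calc l1Norm (fun x => cv f μ x - f x)
      ≤ ex (fun x => ex (fun y => μ y * |f (x - y) - f x|)) := by
        refine ex_mono fun x => ?_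
        simp only [key]
        refine (abs_ex_le _).trans_eq ?_
        simp only [abs_mul, abs_of_nonneg (hμ0 _)]
    _ = ex (fun y => μ y * l1Norm (fun x => f (x - y) - f x)) := by
        rw [ex_comm]
        simp only [ex_const_mul, l1Norm]
    _ ≤ ex (fun y => C * μ y) := by
        refine ex_mono fun y => ?_
        rw [mul_comm C]
        by_cases hy : μ y = 0
        · simp [hy]
        · exact mul_le_mul_of_nonneg_left (hC y hy) (hμ0 y)
    _ = C := by rw [ex_const_mul, hμ1, mul_one]

/-- If `A` and its translate by `y` both lie in `A'`, then `μ_A` is `2(|A'|/|A| - 1)`-close in `L¹`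
to its translate. -/
theorem l1Norm_mu_translate_sub_le {A A' : Set G} (hA : A.Nonempty) (hAA' : A ⊆ A') {y : G}
    (hy : ∀ x, x - y ∈ A → x ∈ A') :
    l1Norm (fun x => mu A (x - y) - mu A x) ≤
      2 * ((Nat.card A' : ℝ) / (Nat.card A : ℝ)) - 2 := by
  have : Nonempty G := ⟨hA.some⟩
  have hG : (Fintype.card G : ℝ) ≠ 0 := Nat.cast_ne_zero.2 Fintype.card_ne_zero
  have hc : 0 ≤ (Fintype.card G : ℝ) / (Nat.card A : ℝ) := by positivity
  calc l1Norm (fun x => mu A (x - y) - mu A x)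
      ≤ ex (fun x => 2 * ((Fintype.card G : ℝ) / (Nat.card A : ℝ)) * indic A' x
          - (mu A (x - y) + mu A x)) := by
        refine ex_mono fun x => ?_
        have h1 := hy x
        have h2 := @hAA' x
        simp only [mu, indic]
        split_ifs <;> first | tauto | (rw [abs_le]; constructor <;> linarith)
    _ = 2 * ((Nat.card A' : ℝ) / (Nat.card A : ℝ)) - 2 := by
        rw [ex_sub, ex_add, ex_const_mul, ex_comp_sub_right, ex_mu hA, ex_indic, density]
        field_simp
        ring

namespace Bohr

theorem add_mem_carrier_dilate {G : Type*} [AddCommGroup G] [Finite G] {B : Bohr G} {r s : ℝ}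
    {x y : G} (hx : x ∈ (B.dilate r).carrier) (hy : y ∈ (B.dilate s).carrier) :
    x + y ∈ (B.dilate (r + s)).carrier := by
  intro γ hγ
  have h : (1 : ℂ) - γ (x + y) = (1 - γ x) + γ x * (1 - γ y) := by
    rw [AddChar.map_add_eq_mul]
    ring
  calc ‖(1 : ℂ) - γ (x + y)‖ ≤ ‖1 - γ x‖ + ‖γ x * (1 - γ y)‖ := h ▸ norm_add_le _ _
    _ = ‖1 - γ x‖ + ‖1 - γ y‖ := by rw [norm_mul, AddChar.norm_apply, one_mul]
    _ ≤ r * B.radius + s * B.radius := add_le_add (hx γ hγ) (hy γ hγ)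
    _ = (r + s) * B.radius := by ring

theorem carrier_dilate_mono {G : Type*} [AddCommGroup G] {B : Bohr G} (hB : 0 ≤ B.radius)
    {r s : ℝ} (hrs : r ≤ s) : (B.dilate r).carrier ⊆ (B.dilate s).carrier :=
  fun _ hx γ hγ => (hx γ hγ).trans (mul_le_mul_of_nonneg_right hrs hB)

theorem zero_mem_carrier {G : Type*} [AddCommGroup G] {B : Bohr G} (hB : 0 ≤ B.radius) :
    (0 : G) ∈ B.carrier := by
  intro γ _
  simpa using hB

theorem dilate_one {G : Type*} [AddCommGroup G] (B : Bohr G) : B.dilate 1 = B := by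
  simp [dilate]

end Bohr

/-- If `μ` is a probability measure supported on `B_ρ` with
`ρ + δ < 1/(100d)`, then `‖μ_{B_{1+δ}}∗μ − μ_{B_{1+δ}}‖₁ ≤ 200(ρ+δ)d`. -/
theorem statement12 (N : ℕ) [NeZero N] (hN : Odd N)
    (B : Bohr (ZMod N)) (d : ℕ) (hB : B.Regular) (hd : B.rank = d)
    (ρ δ : ℝ) (hρ : 0 < ρ) (hδ : 0 < δ) (hρδ : ρ + δ < 1 / (100 * d))
    (μ : ZMod N → ℝ) (hμ0 : ∀ x, 0 ≤ μ x) (hμ1 : ex μ = 1)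
    (hsupp : ∀ x, μ x ≠ 0 → x ∈ (B.dilate ρ).carrier) :
    l1Norm (fun x =>
        cv (mu ((B.dilate (1 + δ)).carrier)) μ x - mu ((B.dilate (1 + δ)).carrier) x) ≤
      200 * (ρ + δ) * d := by
  subst hd
  have hd : 0 < (B.rank : ℝ) := by
    rcases (Nat.cast_nonneg B.rank : (0 : ℝ) ≤ B.rank).eq_or_lt with h | h
    · rw [← h, mul_zero, div_zero] at hρδ
      linarith
    · exact h
  have hrad : 0 ≤ B.radius := by
    obtain ⟨y, hy⟩ : ∃ y, μ y ≠ 0 := by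
      by_contra! h
      simp [ex, h] at hμ1
    obtain ⟨γ, hγ⟩ : B.freq.Nonempty := Finset.card_pos.1 (Nat.cast_pos.1 hd)
    exact nonneg_of_mul_nonneg_right ((norm_nonneg _).trans (hsupp y hy γ hγ)) hρ
  have hsub : B.carrier ⊆ (B.dilate (1 + δ)).carrier := by
    conv_lhs => rw [← B.dilate_one]
    exact Bohr.carrier_dilate_mono hrad (by linarith)
  have h0 := Bohr.zero_mem_carrier hrad
  have : Nonempty B.carrier := ⟨⟨0, h0⟩⟩
  have hBpos : (0 : ℝ) < Nat.card B.carrier := Nat.cast_pos.2 Nat.card_pos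
  have hle : (Nat.card B.carrier : ℝ) ≤ Nat.card (B.dilate (1 + δ)).carrier :=
    Nat.cast_le.2 (Nat.card_mono (Set.toFinite _) hsub)
  have hreg := (hB (ρ + δ) (by rw [abs_of_pos (by linarith)]; exact hρδ.le)).2
  rw [abs_of_pos (by linarith)] at hreg
  refine l1Norm_cv_sub_le hμ0 hμ1 fun y hy => ?_
  refine (l1Norm_mu_translate_sub_le (A' := (B.dilate (1 + (ρ + δ))).carrier) ⟨0, hsub h0⟩
    (Bohr.carrier_dilate_mono hrad (by linarith)) fun x hx => ?_).trans ?_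
  · have h := Bohr.add_mem_carrier_dilate hx (hsupp y hy)
    rwa [sub_add_cancel, add_assoc, add_comm δ] at h
  · have h : (Nat.card (B.dilate (1 + (ρ + δ))).carrier : ℝ) /
        Nat.card (B.dilate (1 + δ)).carrier ≤ 1 + 100 * B.rank * (ρ + δ) :=
      (div_le_iff₀ (hBpos.trans_le hle)).2
        (hreg.trans (mul_le_mul_of_nonneg_left hle (by positivity)))
    linarith

end Formal
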